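/- Let X ⊂ int(𝔸) be an essential annular continuum and assume that (V)₁ is unbounded from below and unbounded from above. Then for every L < 0 there exists R > 1 such that: if γ is a hair of some V + k with k ≤ 0 whose image is contained in V⁻ and (γ(1))₁ ≥ R, then L ∈ (γ)₁. -/

import Mathlib

open Set Function MeasureTheory Filter Topology

noncomputable section

/-- The vertical fiber `[-1,1]`. -/
abbrev II : Set ℝ := Set.Icc (-1 : ℝ) 1

/-- The universal cover `ℝ × [-1,1]` of the annulus. -/
abbrev Strip : Type := ℝ × II

/-- The compact annulus `(ℝ/ℤ) × [-1,1]`. -/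
abbrev Ann : Type := AddCircle (1 : ℝ) × II

/-- The covering projection `π`. -/
def pr (z : Strip) : Ann := ((z.1 : AddCircle (1 : ℝ)), z.2)

/-- The deck transformation `T^k`. -/
def shiftPt (k : ℤ) (z : Strip) : Strip := (z.1 + k, z.2)

/-- `S + k`, the image of `S` under `T^k`. -/
def shiftSet (k : ℤ) (S : Set Strip) : Set Strip := shiftPt k '' S

/-- `f` is isotopic to the identity. -/
def IsotopicToId (f : Ann → Ann) : Prop :=
  ∃ H : ℝ → Ann → Ann, Continuous (fun p : ℝ × Ann => H p.1 p.2) ∧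
    (∀ t : ℝ, Function.Bijective (H t)) ∧ H 0 = id ∧ H 1 = f

/-- `F` is a lift of `f` commuting with the deck transformation. -/
def IsLift (f : Ann → Ann) (F : Strip → Strip) : Prop :=
  (∀ z, pr (F z) = f (pr z)) ∧ (∀ z, F (shiftPt 1 z) = shiftPt 1 (F z))

/-- `X` is an essential annular continuum with complementary components `Um`, `Up`. -/
structure IsEAC (X Um Up : Set Ann) : Prop where
  compact : IsCompact X
  connected : IsConnected X
  inInterior : ∀ p ∈ X, ((p.2 : ℝ)) ∈ Set.Ioo (-1 : ℝ) 1
  hUm : Um = connectedComponentIn Xᶜ ((0 : AddCircle (1 : ℝ)), ⟨-1, le_rfl, by norm_num⟩)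
  hUp : Up = connectedComponentIn Xᶜ ((0 : AddCircle (1 : ℝ)), ⟨1, by norm_num, le_rfl⟩)
  cover : Xᶜ = Um ∪ Up
  ne : Um ≠ Up

/-- An arc `γ : [0,1] → U ∪ {p}` with `γ([0,1)) ⊂ U` and `γ(1) = p`. -/
def IsArcTo (U : Set Strip) (γ : unitInterval → Strip) (p : Strip) : Prop :=
  Continuous γ ∧ Function.Injective γ ∧ (∀ t, t ≠ 1 → γ t ∈ U) ∧ γ 1 = p

/-- `p` is accessible from `U`. -/
def AccFrom (U : Set Strip) (p : Strip) : Prop := ∃ γ, IsArcTo U γ p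

/-- The order `≺` on accessible points, with access arcs starting on `ℝ × {b}`. -/
def PrecB (b : ℝ) (U : Set Strip) (x x' : Strip) : Prop :=
  ∃ γ γ' : unitInterval → Strip,
    IsArcTo U γ x ∧ IsArcTo U γ' x' ∧
    ((γ 0).2 : ℝ) = b ∧ ((γ' 0).2 : ℝ) = b ∧
    Disjoint (range γ) (range γ') ∧ (γ 0).1 < (γ' 0).1

/-- `k = k(x,y)` is the unique integer with `T^k(y) ⪯ x ≺ T^{k+1}(y)`. -/
def AccIdxB (b : ℝ) (U : Set Strip) (x y : Strip) (k : ℤ) : Prop :=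
  (shiftPt k y = x ∨ PrecB b U (shiftPt k y) x) ∧ PrecB b U x (shiftPt (k + 1) y)

/-- `ρ` is the prime end rotation number of the lift `F` as seen from `U`
(access arcs starting at height `b`): `k(Fⁿ(x), y)/n → ρ` for all accessible `x, y`. -/
def PrimeEndRotB (b : ℝ) (U Xt : Set Strip) (F : Strip → Strip) (ρ : ℝ) : Prop :=
  ∀ x ∈ Xt, ∀ y ∈ Xt, AccFrom U x → AccFrom U y →
    ∀ k : ℕ → ℤ, (∀ n : ℕ, AccIdxB b U (F^[n] x) y (k n)) →
      Tendsto (fun n : ℕ => (k n : ℝ) / (n : ℝ)) atTop (𝓝 ρ)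

/-- The measure-theoretic rotation set `ρ_mes(g̃, X)`, where `φ` is the displacement
function of the lift `g̃` (pushed down to the annulus). -/
def rotMes (g : Ann → Ann) (φ : Ann → ℝ) (X : Set Ann) : Set ℝ :=
  {r | ∃ μ : Measure Ann, IsProbabilityMeasure μ ∧ Measure.map g μ = μ ∧
    μ Xᶜ = 0 ∧ ∫ a, φ a ∂μ = r}

/-- A point in the interior of the top boundary segment `(0,1) × {1}`. -/
def topSeg : Strip := ((1 : ℝ) / 2, ⟨1, by norm_num, le_rfl⟩)

/-- `β' = β ∖ {x₀} = {0} × (η, 1]`. -/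
def betaP (η : ℝ) : Set Strip := {z : Strip | z.1 = 0 ∧ η < (z.2 : ℝ)}

/-- `η = max{y : (0,y) ∈ X̃}`. -/
def etaSpec (Xt : Set Strip) (η : ℝ) : Prop :=
  IsGreatest {y : ℝ | ∃ z ∈ Xt, z.1 = 0 ∧ (z.2 : ℝ) = y} η

/-- The fundamental region `V`: the closure, relative to `Ũ₊`, of the connected
component of `Ũ₊ ∖ (β' ∪ (β' + 1))` containing the segment `(0,1) × {1}`. -/
def Vset (Utp : Set Strip) (η : ℝ) : Set Strip :=
  Utp ∩ closure (connectedComponentIn (Utp \ (betaP η ∪ shiftSet 1 (betaP η))) topSeg)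

/-- A hair of `W`: an arc in `W` starting on `ℝ × {1}`. -/
def IsHair (W : Set Strip) (γ : unitInterval → Strip) : Prop :=
  Continuous γ ∧ Function.Injective γ ∧ ((γ 0).2 : ℝ) = 1 ∧ ∀ t, γ t ∈ W

/-- `(γ)₁`, the projection of the image of `γ` to the first coordinate. -/
def proj1 (γ : unitInterval → Strip) : Set ℝ := range fun t => (γ t).1

/-- `(V + k)⁻ = ⋃_{j ≤ k} (V + j)`. -/
def VMinus (k : ℤ) (V : Set Strip) : Set Strip := ⋃ j ∈ Iic k, shiftSet j V

/-- `(V + k)⁺ = ⋃_{j ≥ k} (V + j)`. -/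
def VPlus (k : ℤ) (V : Set Strip) : Set Strip := ⋃ j ∈ Ici k, shiftSet j V

/-- A crosscut of `Ũ₊`: an arc with endpoints on `X̃` and interior in `Ũ₊`. -/
def IsCrosscut (Utp Xt : Set Strip) (c : unitInterval → Strip) : Prop :=
  Continuous c ∧ Function.Injective c ∧ c 0 ∈ Xt ∧ c 1 ∈ Xt ∧
    ∀ t, t ≠ 0 → t ≠ 1 → c t ∈ Utp

/-- `F^n` for `n : ℤ`. -/
def iterZ (F : Strip ≃ₜ Strip) (n : ℤ) : Strip → Strip := fun z => (F.toEquiv ^ n) z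

end

section HairAux


lemma aux_theta_lift {A : Type*} [TopologicalSpace A] (f : unitInterval × A → ℂ) (hf : Continuous f)
    (h0 : ∀ x, f x ≠ 0) (θ₀ : A → ℝ) (hθ₀ : Continuous θ₀)
    (hre : ∀ a, (f (0, a)).re = ‖f (0, a)‖ * Real.cos (θ₀ a))
    (him : ∀ a, (f (0, a)).im = ‖f (0, a)‖ * Real.sin (θ₀ a)) :
    ∃ θ : unitInterval × A → ℝ, Continuous θ ∧ (∀ a, θ (0, a) = θ₀ a) ∧
      (∀ x, (f x).re = ‖f x‖ * Real.cos (θ x)) ∧ (∀ x, (f x).im = ‖f x‖ * Real.sin (θ x)) := by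
  have hn : ∀ x, ‖f x‖ ≠ 0 := fun x => norm_ne_zero_iff.2 (h0 x)
  let H : C(unitInterval × A, Circle) := ⟨fun x => ⟨f x / (‖f x‖ : ℂ), by
    simp [Submonoid.unitSphere, hn x]⟩, by
    refine Continuous.subtype_mk ?_ _
    refine hf.div (Complex.continuous_ofReal.comp hf.norm) ?_
    intro x; exact_mod_cast hn x⟩
  have hH0 : ∀ a, H (0, a) = Circle.exp ((⟨θ₀, hθ₀⟩ : C(A, ℝ)) a) := by
    intro a
    apply Circle.ext
    have hc : ((‖f (0,a)‖ : ℝ) : ℂ) ≠ 0 := by exact_mod_cast hn (0,a)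
    change f (0,a) / (‖f (0,a)‖ : ℂ) = Circle.exp (θ₀ a)
    rw [Circle.coe_exp, div_eq_iff hc]
    apply Complex.ext
    · rw [hre a, mul_comm, Complex.re_mul_ofReal, Complex.exp_ofReal_mul_I_re]
    · rw [him a, mul_comm, Complex.im_mul_ofReal, Complex.exp_ofReal_mul_I_im]
  have key : ∀ x, f x = Complex.exp
      (((Circle.isCoveringMap_exp.liftHomotopy H ⟨θ₀, hθ₀⟩ hH0 x : ℝ) : ℂ) * Complex.I) * ‖f x‖ := by
    intro x
    have hc : ((‖f x‖ : ℝ) : ℂ) ≠ 0 := by exact_mod_cast hn x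
    have := congrFun (Circle.isCoveringMap_exp.liftHomotopy_lifts H ⟨θ₀, hθ₀⟩ hH0) x
    have := congrArg (fun z : Circle => (z : ℂ)) this
    simp only [Function.comp_apply, Circle.coe_exp] at this
    rw [this]
    change f x = f x / (‖f x‖ : ℂ) * _
    field_simp
  refine ⟨Circle.isCoveringMap_exp.liftHomotopy H ⟨θ₀, hθ₀⟩ hH0, ContinuousMap.continuous _,
    fun a => Circle.isCoveringMap_exp.liftHomotopy_zero H ⟨θ₀, hθ₀⟩ hH0 a, ?_, ?_⟩
  · intro x
    have := congrArg Complex.re (key x)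
    rw [Complex.re_mul_ofReal, Complex.exp_ofReal_mul_I_re] at this
    rw [this, mul_comm]
  · intro x
    have := congrArg Complex.im (key x)
    rw [Complex.im_mul_ofReal, Complex.exp_ofReal_mul_I_im] at this
    rw [this, mul_comm]

lemma aux_stay_lt (g : unitInterval → ℝ) (hg : Continuous g) (c : ℝ) (hc : ∀ t, g t ≠ c) (t₀ : unitInterval)
    (h0 : g t₀ < c) (t : unitInterval) : g t < c := by
  by_contra h
  push Not at h
  obtain ⟨s, hs⟩ := mem_range_of_exists_le_of_exists_ge hg ⟨t₀, h0.le⟩ ⟨t, h⟩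
  exact hc s hs

lemma aux_stay_gt (g : unitInterval → ℝ) (hg : Continuous g) (c : ℝ) (hc : ∀ t, g t ≠ c) (t₀ : unitInterval)
    (h0 : c < g t₀) (t : unitInterval) : c < g t := by
  by_contra h
  push Not at h
  obtain ⟨s, hs⟩ := mem_range_of_exists_le_of_exists_ge hg ⟨t, h⟩ ⟨t₀, h0.le⟩
  exact hc s hs

/-- if `sin g ≥ 0` and `g` starts at `0`, then `g` stays in `[0, π]`. -/
lemma aux_sin_nonneg (g : unitInterval → ℝ) (hg : Continuous g) (h0 : g 0 = 0)
    (hs : ∀ t, 0 ≤ Real.sin (g t)) (t : unitInterval) : 0 ≤ g t ∧ g t ≤ Real.pi := by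
  have hpi := Real.pi_pos
  constructor
  · by_contra h
    push Not at h
    obtain ⟨s, hs'⟩ := mem_range_of_exists_le_of_exists_ge (f := g) (c := max (g t) (-1)) hg
      ⟨t, le_max_left _ _⟩ ⟨0, by rw [h0]; exact max_le h.le (by norm_num)⟩
    have h1 : max (g t) (-1) < 0 := max_lt h (by norm_num)
    have h2 : -1 ≤ max (g t) (-1) := le_max_right _ _
    have := Real.sin_neg_of_neg_of_neg_pi_lt h1 (by linarith [Real.pi_gt_three])
    have := hs s
    rw [hs'] at this
    linarith
  · by_contra h
    push Not at h
    obtain ⟨s, hs'⟩ := mem_range_of_exists_le_of_exists_ge (f := g) (c := min (g t) (Real.pi + 1)) hg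
      ⟨0, by rw [h0]; exact le_min (by linarith) (by linarith)⟩ ⟨t, min_le_left _ _⟩
    have h1 : Real.pi < min (g t) (Real.pi + 1) := lt_min h (by linarith)
    have h2 : min (g t) (Real.pi + 1) ≤ Real.pi + 1 := min_le_right _ _
    have := Real.sin_neg_of_neg_of_neg_pi_lt (x := min (g t) (Real.pi + 1) - 2 * Real.pi)
      (by linarith [Real.pi_gt_three]) (by linarith)
    rw [Real.sin_sub_two_pi] at this
    have := hs s
    rw [hs'] at this
    linarith

lemma aux_crossing (f : unitInterval × unitInterval → ℂ) (hf : Continuous f) (h0 : ∀ x, f x ≠ 0)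
    (hc : 0 < (f (0, 0)).re) (hc' : (f (0,0)).im = 0)
    (h1 : ∀ t, 0 ≤ (f (0, t)).im) (h2 : ∀ s, (f (s, 0)).im ≤ 0)
    (h3 : ∀ t, (f (1, t)).re < 0) (h4 : ∀ s, (f (s, 1)).re < 0) : False := by
  have hpi := Real.pi_pos
  have hn : ∀ x, 0 < ‖f x‖ := fun x => norm_pos_iff.2 (h0 x)
  have hcorner : f (0,0) = (((f (0,0)).re : ℝ) : ℂ) := by
    apply Complex.ext <;> simp [hc']
  have hnorm : ‖f (0,0)‖ = (f (0,0)).re := by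
    rw [hcorner, Complex.norm_real, Real.norm_eq_abs, Complex.ofReal_re, abs_of_pos hc]
  obtain ⟨φ, hφ, hφ0, hφr, hφi⟩ := aux_theta_lift (A := Unit) (fun x => f (0, x.1))
    (by fun_prop) (fun x => h0 _) (fun _ => 0) continuous_const
    (by intro a; simp [hnorm]) (by intro a; simp [hc'])
  obtain ⟨θ, hθ, hθ0, hθr, hθi⟩ := aux_theta_lift f hf h0 (fun t => φ (t, ()))
    (by fun_prop) (fun a => hφr (a, ())) (fun a => hφi (a, ()))
  have hstart : θ (0,0) = 0 := by rw [hθ0, hφ0]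
  have hsin : ∀ x, 0 ≤ (f x).im → 0 ≤ Real.sin (θ x) := by
    intro x hx
    rw [hθi x] at hx
    exact nonneg_of_mul_nonneg_right hx (hn x)
  have hsin' : ∀ x, (f x).im ≤ 0 → Real.sin (θ x) ≤ 0 := by
    intro x hx
    rw [hθi x] at hx
    exact nonpos_of_mul_nonpos_right hx (hn x)
  have hcos : ∀ x, (f x).re < 0 → Real.cos (θ x) < 0 := by
    intro x hx
    rw [hθr x] at hx
    exact neg_of_mul_neg_right hx (hn x).le
  have a1 := aux_sin_nonneg (fun t => θ (0, t)) (by fun_prop) hstart (fun t => hsin _ (h1 t)) 1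
  have a2 := aux_sin_nonneg (fun s => -θ (s, 0)) (by fun_prop) (by simp [hstart])
    (fun t => by rw [Real.sin_neg]; linarith [hsin' _ (h2 t)]) 1
  have ne4 : ∀ s, θ (s, 1) ≠ 0 := by
    intro s hs
    have := hcos _ (h4 s)
    rw [hs, Real.cos_zero] at this
    linarith
  have ne3 : ∀ t, θ (1, t) ≠ 0 := by
    intro s hs
    have := hcos _ (h3 s)
    rw [hs, Real.cos_zero] at this
    linarith
  have b1 : 0 < θ (0, 1) := lt_of_le_of_ne a1.1 (ne4 0).symm
  have b2 : 0 < θ (1, 1) := aux_stay_gt (fun s => θ (s, 1)) (by fun_prop) 0 ne4 0 b1 1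
  have b3 : 0 < θ (1, 0) := aux_stay_gt (fun t => θ (1, t)) (by fun_prop) 0 ne3 1 b2 0
  linarith [a2.1]

/-- The retraction of the plane onto the strip. -/
noncomputable def auxClamp (z : ℝ × ℝ) : Strip := (z.1, Set.projIcc (-1 : ℝ) 1 (by norm_num) z.2)

lemma auxClamp_quot : IsQuotientMap auxClamp := by
  refine IsQuotientMap.of_inverse (f := fun z : Strip => (z.1, (z.2 : ℝ))) ?_ ?_ ?_
  · fun_prop
  · unfold auxClamp
    have := continuous_projIcc (a := (-1:ℝ)) (b := 1) (h := by norm_num)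
    fun_prop
  · intro z
    simp [auxClamp]

instance auxStripLoc : LocallyPathConnectedSpace Strip := auxClamp_quot.locallyPathConnectedSpace

lemma aux_pr_cont : Continuous pr := by
  unfold pr
  exact ((AddCircle.continuous_mk' (1:ℝ)).comp continuous_fst).prodMk continuous_snd

lemma aux_pr_open : IsOpenMap pr := by
  have : IsOpenMap (Prod.map (fun x : ℝ => (x : AddCircle (1:ℝ))) (id : II → II)) :=
    QuotientAddGroup.isOpenMap_coe.prodMap IsOpenMap.id
  exact this

lemma aux_pr_surj : Function.Surjective pr := by
  rintro ⟨a, y⟩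
  obtain ⟨x, rfl⟩ := QuotientAddGroup.mk_surjective a
  exact ⟨(x, y), rfl⟩

instance auxAnnLoc : LocallyPathConnectedSpace Ann :=
  (aux_pr_open.isQuotientMap aux_pr_cont aux_pr_surj).locallyPathConnectedSpace

instance auxStripConn : ConnectedSpace Strip := auxClamp_quot.surjective.connectedSpace
  auxClamp_quot.continuous

instance auxAnnConn : ConnectedSpace Ann := aux_pr_surj.connectedSpace aux_pr_cont

lemma aux_pr_shift (k : ℤ) (z : Strip) : pr (shiftPt k z) = pr z := by
  unfold pr shiftPt
  simp

lemma aux_circle_preconn (y : II) : IsPreconnected {p : Ann | p.2 = y} := by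
  have : {p : Ann | p.2 = y} = range (fun a : AddCircle (1:ℝ) => ((a, y) : Ann)) := by
    ext ⟨a, b⟩
    simp [eq_comm]
  rw [this]
  exact isPreconnected_range (by fun_prop)

variable {X Um Up : Set Ann}

lemma aux_top (hX : IsEAC X Um Up) (p : Ann) (hp : (p.2 : ℝ) = 1) : p ∈ Up := by
  rw [hX.hUp]
  refine (aux_circle_preconn ⟨1, by norm_num, le_rfl⟩).subset_connectedComponentIn rfl ?_
    (Subtype.ext hp)
  intro q hq hqX
  have h1 := hX.inInterior q hqX
  have h2 : (q.2 : ℝ) = 1 := congrArg Subtype.val hq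
  rw [h2] at h1
  exact absurd h1.2 (lt_irrefl _)

lemma aux_bot (hX : IsEAC X Um Up) (p : Ann) (hp : (p.2 : ℝ) = -1) : p ∈ Um := by
  rw [hX.hUm]
  refine (aux_circle_preconn ⟨-1, le_rfl, by norm_num⟩).subset_connectedComponentIn rfl ?_
    (Subtype.ext hp)
  intro q hq hqX
  have h1 := hX.inInterior q hqX
  have h2 : (q.2 : ℝ) = -1 := congrArg Subtype.val hq
  rw [h2] at h1
  exact absurd h1.1 (lt_irrefl _)

lemma aux_Up_open (hX : IsEAC X Um Up) : IsOpen Up := by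
  rw [hX.hUp]
  exact hX.compact.isClosed.isOpen_compl.connectedComponentIn

lemma aux_Um_open (hX : IsEAC X Um Up) : IsOpen Um := by
  rw [hX.hUm]
  exact hX.compact.isClosed.isOpen_compl.connectedComponentIn

lemma aux_disj (hX : IsEAC X Um Up) (p : Ann) (h1 : p ∈ Um) (h2 : p ∈ Up) : False := by
  apply hX.ne
  have e1 := hX.hUm
  have e2 := hX.hUp
  rw [e1] at h1
  rw [e2] at h2
  rw [e1, e2, connectedComponentIn_eq h1, connectedComponentIn_eq h2]

lemma aux_X_notUp (hX : IsEAC X Um Up) (p : Ann) (h1 : p ∈ X) (h2 : p ∈ Up) : False := by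
  have : p ∈ Xᶜ := by rw [hX.cover]; exact Or.inr h2
  exact this h1

lemma aux_E_conn (hX : IsEAC X Um Up) : IsPreconnected Upᶜ := by
  have hUm : IsPreconnected Um := by
    rw [hX.hUm]; exact isPreconnected_connectedComponentIn
  have hbot : ((0 : AddCircle (1 : ℝ)), (⟨-1, le_rfl, by norm_num⟩ : II)) ∈ Um := aux_bot hX _ rfl
  obtain ⟨x, hx⟩ := hX.connected.nonempty
  have hmX : ∀ p ∈ X, p ∉ Um := by
    intro p hp hm
    have : p ∈ Xᶜ := by rw [hX.cover]; exact Or.inl hm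
    exact this hp
  have hnc : ¬ IsClosed Um := by
    intro hcl
    rcases isClopen_iff.1 (⟨hcl, aux_Um_open hX⟩ : IsClopen Um) with h | h
    · rw [h] at hbot; exact hbot
    · exact hmX x hx (h ▸ mem_univ x)
  have : ∃ p ∈ closure Um, p ∉ Um := by
    by_contra h
    push Not at h
    exact hnc (isClosed_of_closure_subset h)
  obtain ⟨p, hpc, hpm⟩ := this
  have hpX : p ∈ X := by
    by_contra hpX
    have : p ∈ Xᶜ := hpX
    rw [hX.cover] at this
    rcases this with h | h
    · exact hpm h
    · obtain ⟨q, hq1, hq2⟩ := mem_closure_iff.1 hpc Up (aux_Up_open hX) h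
      exact aux_disj hX q hq2 hq1
  have h1 : IsPreconnected (insert p Um) :=
    hUm.subset_closure (subset_insert _ _) (insert_subset hpc subset_closure)
  have h2 : IsPreconnected (insert p Um ∪ X) :=
    IsPreconnected.union p (mem_insert _ _) hpX h1 hX.connected.isPreconnected
  have h3 : Upᶜ = insert p Um ∪ X := by
    ext q
    constructor
    · intro hq
      by_cases hqX : q ∈ X
      · exact Or.inr hqX
      · have : q ∈ Xᶜ := hqX
        rw [hX.cover] at this
        exact Or.inl (Or.inr (this.resolve_right hq))
    · rintro ((rfl | h) | h) hu
      · exact aux_X_notUp hX _ hpX hu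
      · exact aux_disj hX _ h hu
      · exact aux_X_notUp hX _ h hu
  rw [h3]; exact h2

/-- The complement of the lift of `Up`, as a type. -/
abbrev AuxE (Up : Set Ann) : Type := {q : Strip // pr q ∉ Up}

lemma aux_no_path (hX : IsEAC X Um Up) {η : ℝ} (hη : etaSpec (pr ⁻¹' X) η) (a : ℝ) (ha : 1 < a)
    (δ : unitInterval → Strip) (hδ : Continuous δ) (h0 : δ 0 = topSeg)
    (h1 : (δ 1).1 = a) (h1' : ((δ 1).2 : ℝ) = 1) (hU : ∀ t, pr (δ t) ∈ Up)
    (hβ : ∀ t, ¬ ((δ t).1 = 1 ∧ η < ((δ t).2 : ℝ))) : False := by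
  have hpi := Real.pi_pos
  have hlt : ∀ q : (AuxE Up), (q.1.2 : ℝ) < 1 := by
    intro q
    refine lt_of_le_of_ne q.1.2.2.2 ?_
    intro h
    exact q.2 (aux_top hX _ h)
  have h01 : (δ 0).1 = 1 / 2 := by rw [h0]; rfl
  have h02 : ((δ 0).2 : ℝ) = 1 := by rw [h0]; rfl
  let f : unitInterval × (AuxE Up) → ℂ := fun x =>
    (((δ x.1).1 - x.2.1.1 : ℝ) : ℂ) + ((((δ x.1).2 : ℝ) - (x.2.1.2 : ℝ) : ℝ) : ℂ) * Complex.I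
  have hfre : ∀ x, (f x).re = (δ x.1).1 - x.2.1.1 := by intro x; simp [f]
  have hfim : ∀ x, (f x).im = ((δ x.1).2 : ℝ) - (x.2.1.2 : ℝ) := by intro x; simp [f]
  have hf : Continuous f := by
    have hA : Continuous (fun x : unitInterval × (AuxE Up) => x.2.1) :=
      Continuous.comp (g := (Subtype.val : (AuxE Up) → Strip)) continuous_subtype_val continuous_snd
    fun_prop
  have hf0 : ∀ x, f x ≠ 0 := by
    intro x hx
    have e1 := hfre x
    have e2 := hfim x
    rw [hx] at e1 e2
    simp only [Complex.zero_re, Complex.zero_im] at e1 e2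
    have : δ x.1 = x.2.1 := Prod.ext (by linarith) (Subtype.ext (by linarith))
    exact x.2.2 (this ▸ hU x.1)
  have hn : ∀ x, 0 < ‖f x‖ := fun x => norm_pos_iff.2 (hf0 x)
  have him0 : ∀ q : (AuxE Up), 0 < (f (0, q)).im := by
    intro q; rw [hfim]; have := hlt q; simp only; linarith
  have him1 : ∀ q : (AuxE Up), 0 < (f (1, q)).im := by
    intro q; rw [hfim]; have := hlt q; simp only; linarith
  obtain ⟨θ, hθ, hθ0, hθr, hθi⟩ := aux_theta_lift f hf hf0 (fun q => Complex.arg (f (0, q)))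
    (by
      rw [continuous_iff_continuousAt]
      intro q
      have hc : Continuous (fun q : (AuxE Up) => f (0, q)) := by fun_prop
      exact ContinuousAt.comp (f := fun q : (AuxE Up) => f (0, q)) (Complex.continuousAt_arg (Or.inr (him0 q).ne')) hc.continuousAt)
    (fun q => (Complex.norm_mul_cos_arg _).symm)
    (fun q => (Complex.norm_mul_sin_arg _).symm)
  have hsin : ∀ x, 0 < (f x).im → 0 < Real.sin (θ x) := by
    intro x hx
    rw [hθi x] at hx
    exact pos_of_mul_pos_right hx (hn x).le
  have hcosp : ∀ x, 0 < (f x).re → 0 < Real.cos (θ x) := by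
    intro x hx
    rw [hθr x] at hx
    exact pos_of_mul_pos_right hx (hn x).le
  have hcosn : ∀ x, (f x).re < 0 → Real.cos (θ x) < 0 := by
    intro x hx
    rw [hθr x] at hx
    exact neg_of_mul_neg_right hx (hn x).le
  have hcont : ∀ q : (AuxE Up), Continuous (fun t => θ (t, q)) := fun q => by fun_prop
  have hst : ∀ q : (AuxE Up), 0 < θ (0, q) ∧ θ (0, q) < Real.pi := by
    intro q
    have hs := hsin _ (him0 q)
    have l1 : 0 ≤ θ (0, q) := by rw [hθ0]; exact Complex.arg_nonneg_iff.2 (him0 q).le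
    have l2 : θ (0, q) ≤ Real.pi := by rw [hθ0]; exact Complex.arg_le_pi _
    constructor
    · refine lt_of_le_of_ne l1 ?_
      intro h; rw [← h, Real.sin_zero] at hs; exact lt_irrefl _ hs
    · refine lt_of_le_of_ne l2 ?_
      intro h; rw [h, Real.sin_pi] at hs; exact lt_irrefl _ hs
  have hend : ∀ q : (AuxE Up), θ (1, q) ≠ 0 ∧ θ (1, q) ≠ Real.pi := by
    intro q
    have hs := hsin _ (him1 q)
    constructor
    · intro h; rw [h, Real.sin_zero] at hs; exact lt_irrefl _ hs
    · intro h; rw [h, Real.sin_pi] at hs; exact lt_irrefl _ hs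
  let B : Set (AuxE Up) := {q | ¬ (0 < θ (1, q) ∧ θ (1, q) < Real.pi)}
  have hc1 : Continuous (fun q : (AuxE Up) => θ (1, q)) := by fun_prop
  have hBclosed : IsClosed B := by
    have : IsOpen {q : (AuxE Up) | 0 < θ (1, q) ∧ θ (1, q) < Real.pi} :=
      (isOpen_lt continuous_const hc1).inter (isOpen_lt hc1 continuous_const)
    exact this.isClosed_compl
  have hBopen : IsOpen B := by
    have h : IsClosed {q : (AuxE Up) | 0 ≤ θ (1, q) ∧ θ (1, q) ≤ Real.pi} :=
      (isClosed_le continuous_const hc1).inter (isClosed_le hc1 continuous_const)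
    have e : B = {q : (AuxE Up) | 0 ≤ θ (1, q) ∧ θ (1, q) ≤ Real.pi}ᶜ := by
      ext q
      have := hend q
      simp only [B, mem_ofPred_eq, mem_compl_iff]
      rw [not_iff_not]
      constructor
      · rintro ⟨x, y⟩; exact ⟨x.le, y.le⟩
      · rintro ⟨x, y⟩; exact ⟨lt_of_le_of_ne x this.1.symm, lt_of_le_of_ne y this.2⟩
    rw [e]; exact h.isOpen_compl
  -- boundedness of the path
  obtain ⟨M, hM⟩ : ∃ M, ∀ t, |(δ t).1| < M := by
    have hcp : IsCompact (range fun t => |(δ t).1|) := isCompact_range (by fun_prop)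
    obtain ⟨M, hM⟩ := hcp.bddAbove
    exact ⟨M + 1, fun t => by linarith [hM ⟨t, rfl⟩]⟩
  have hBbd : ∀ q ∈ B, q.1.1 ∈ Icc (-M) M := by
    intro q hq
    by_contra hcon
    apply hq
    have hs := hsin _ (him1 q)
    have hst' := hst q
    rw [mem_Icc, not_and_or, not_le, not_le] at hcon
    rcases hcon with hcon | hcon
    · have hcp : ∀ t, 0 < Real.cos (θ (t, q)) := by
        intro t
        apply hcosp
        rw [hfre]
        have := (abs_lt.1 (hM t)).1
        simp only
        linarith
      have hc0 := hcp 0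
      have s0 : θ (0, q) < Real.pi / 2 := by
        by_contra hh
        push Not at hh
        have := Real.cos_nonpos_of_pi_div_two_le_of_le hh (by linarith)
        linarith
      have s1 : θ (1, q) < Real.pi / 2 := by
        refine aux_stay_lt _ (hcont q) _ ?_ 0 s0 1
        intro t ht
        have := hcp t
        rw [ht, Real.cos_pi_div_two] at this
        exact lt_irrefl _ this
      have s2 : -(Real.pi / 2) < θ (1, q) := by
        refine aux_stay_gt _ (hcont q) _ ?_ 0 (by linarith) 1
        intro t ht
        have := hcp t
        rw [ht, Real.cos_neg, Real.cos_pi_div_two] at this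
        exact lt_irrefl _ this
      refine ⟨?_, by linarith⟩
      by_contra hh
      push Not at hh
      have := Real.sin_nonpos_of_nonpos_of_neg_pi_le hh (by linarith)
      linarith
    · have hcn : ∀ t, Real.cos (θ (t, q)) < 0 := by
        intro t
        apply hcosn
        rw [hfre]
        have := (abs_lt.1 (hM t)).2
        simp only
        linarith
      have hc0 := hcn 0
      have s0 : Real.pi / 2 < θ (0, q) := by
        by_contra hh
        push Not at hh
        have := Real.cos_nonneg_of_neg_pi_div_two_le_of_le (by linarith) hh
        linarith
      have s1 : Real.pi / 2 < θ (1, q) := by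
        refine aux_stay_gt _ (hcont q) _ ?_ 0 s0 1
        intro t ht
        have := hcn t
        rw [ht, Real.cos_pi_div_two] at this
        exact lt_irrefl _ this
      have s2 : θ (1, q) < Real.pi / 2 + Real.pi := by
        refine aux_stay_lt _ (hcont q) _ ?_ 0 (by linarith) 1
        intro t ht
        have := hcn t
        rw [ht, Real.cos_add_pi, Real.cos_pi_div_two, neg_zero] at this
        exact lt_irrefl _ this
      refine ⟨by linarith, ?_⟩
      by_contra hh
      push Not at hh
      have := Real.sin_nonneg_of_nonneg_of_le_pi (x := θ (1, q) - Real.pi)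
        (by linarith) (by linarith)
      rw [Real.sin_sub_pi] at this
      linarith
  have hBbot : ∀ q ∈ B, (q.1.2 : ℝ) ≠ -1 := by
    intro q hq hcon
    apply hq
    have hst' := hst q
    have hs : ∀ t, 0 < Real.sin (θ (t, q)) := by
      intro t
      apply hsin
      rw [hfim]
      simp only
      rw [hcon]
      have h3 := (δ t).2.2.1
      rcases h3.lt_or_eq with h | h
      · linarith
      · exact (aux_disj hX _ (aux_bot hX (pr (δ t)) h.symm) (hU t)).elim
    constructor
    · refine aux_stay_gt _ (hcont q) _ ?_ 0 hst'.1 1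
      intro t ht
      have := hs t
      rw [ht, Real.sin_zero] at this
      exact lt_irrefl _ this
    · refine aux_stay_lt _ (hcont q) _ ?_ 0 hst'.2 1
      intro t ht
      have := hs t
      rw [ht, Real.sin_pi] at this
      exact lt_irrefl _ this
  -- the point `(1, η)`
  obtain ⟨⟨z, hzX, hz1, hz2⟩, -⟩ := hη
  have hq0 : pr (shiftPt 1 z) ∉ Up := by
    rw [aux_pr_shift]
    exact fun h => aux_X_notUp hX _ hzX h
  let q0 : (AuxE Up) := ⟨shiftPt 1 z, hq0⟩
  have hq01 : q0.1.1 = 1 := by simp [q0, shiftPt, hz1]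
  have hq02 : (q0.1.2 : ℝ) = η := by simp [q0, shiftPt, hz2]
  have hq0B : q0 ∈ B := by
    rintro ⟨b1, b2⟩
    have hst' := hst q0
    have hc0 : Real.cos (θ (0, q0)) < 0 := by
      apply hcosn
      rw [hfre]
      simp only
      rw [hq01, h01]; norm_num
    have hc1 : 0 < Real.cos (θ (1, q0)) := by
      apply hcosp
      rw [hfre]
      simp only
      rw [hq01, h1]; linarith
    have s0 : Real.pi / 2 < θ (0, q0) := by
      by_contra hh
      push Not at hh
      have := Real.cos_nonneg_of_neg_pi_div_two_le_of_le (by linarith) hh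
      linarith
    have s1 : Real.pi / 2 < θ (1, q0) := by
      refine aux_stay_gt _ (hcont q0) _ ?_ 0 s0 1
      intro t ht
      have e1 := hθr (t, q0)
      have e2 := hθi (t, q0)
      rw [ht, Real.cos_pi_div_two, hfre] at e1
      rw [ht, Real.sin_pi_div_two, hfim] at e2
      simp only at e1 e2
      rw [hq01] at e1
      rw [hq02] at e2
      exact hβ t ⟨by linarith, by linarith [hn (t, q0)]⟩
    have := Real.cos_nonpos_of_pi_div_two_le_of_le s1.le (by linarith)
    linarith
  -- conclude by connectedness
  obtain ⟨O, hO, hOB⟩ := isOpen_induced_iff.1 hBopen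
  have hAclosed : IsClosed {q : Strip | pr q ∉ Up} :=
    ((aux_Up_open hX).preimage aux_pr_cont).isClosed_compl
  have hBS : IsClosed (Subtype.val '' B : Set Strip) :=
    hAclosed.isClosedEmbedding_subtypeVal.isClosedMap _ hBclosed
  have hBcomp : IsCompact (Subtype.val '' B : Set Strip) := by
    refine ((isCompact_Icc (a := -M) (b := M)).prod (isCompact_univ (X := II))).of_isClosed_subset
      hBS ?_
    rintro _ ⟨q, hq, rfl⟩
    exact ⟨hBbd q hq, mem_univ _⟩
  have hK : IsClosed (pr '' (Subtype.val '' B : Set Strip)) := (hBcomp.image aux_pr_cont).isClosed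
  have hEO : ∀ e ∈ Upᶜ, e ∈ pr '' O → e ∈ pr '' (Subtype.val '' B : Set Strip) := by
    rintro e he ⟨o, ho, rfl⟩
    refine ⟨o, ⟨⟨o, he⟩, ?_, rfl⟩, rfl⟩
    rw [← hOB]; exact ho
  have hconn := aux_E_conn hX (pr '' O) (pr '' (Subtype.val '' B : Set Strip))ᶜ
    (aux_pr_open O hO) hK.isOpen_compl ?_ ?_ ?_
  · obtain ⟨e, he, he1, he2⟩ := hconn
    exact he2 (hEO e he he1)
  · intro e he
    by_cases h : e ∈ pr '' (Subtype.val '' B : Set Strip)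
    · left
      obtain ⟨_, ⟨q, hq, rfl⟩, rfl⟩ := h
      rw [← hOB] at hq
      exact ⟨q.1, hq, rfl⟩
    · exact Or.inr h
  · refine ⟨pr q0.1, q0.2, q0.1, ?_, rfl⟩
    have := hq0B
    rw [← hOB] at this
    exact this
  · refine ⟨((0 : AddCircle (1 : ℝ)), ⟨-1, le_rfl, by norm_num⟩), ?_, ?_⟩
    · intro h
      exact aux_disj hX _ (aux_bot hX _ rfl) h
    · rintro ⟨_, ⟨q, hq, rfl⟩, h⟩
      apply hBbot q hq
      have := congrArg (fun p : Ann => (p.2 : ℝ)) h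
      exact this

lemma aux_mem_shift_beta {η : ℝ} (z : Strip) :
    z ∈ shiftSet 1 (betaP η) ↔ z.1 = 1 ∧ η < (z.2 : ℝ) := by
  constructor
  · rintro ⟨w, ⟨h1, h2⟩, rfl⟩
    exact ⟨by simp [shiftPt, h1], h2⟩
  · rintro ⟨h1, h2⟩
    refine ⟨(0, z.2), ⟨rfl, h2⟩, Prod.ext (by simp [shiftPt, h1]) rfl⟩

lemma aux_not_joined (hX : IsEAC X Um Up) {η : ℝ} (hη : etaSpec (pr ⁻¹' X) η) (p : Strip)
    (hp : 1 < p.1) (hp' : (p.2 : ℝ) = 1)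
    (h : JoinedIn (pr ⁻¹' Up \ shiftSet 1 (betaP η)) topSeg p) : False := by
  obtain ⟨δ, hδ⟩ := h
  refine aux_no_path hX hη p.1 hp δ δ.continuous δ.source (by simp) (by simp [hp'])
    (fun t => (hδ t).1) ?_
  intro t ht
  exact (hδ t).2 ((aux_mem_shift_beta _).2 ht)

lemma aux_S_open (hX : IsEAC X Um Up) {η : ℝ} (hη : etaSpec (pr ⁻¹' X) η) :
    IsOpen (pr ⁻¹' Up \ (betaP η ∪ shiftSet 1 (betaP η))) := by
  obtain ⟨⟨z, hzX, hz1, hz2⟩, -⟩ := hη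
  have e : pr ⁻¹' Up \ (betaP η ∪ shiftSet 1 (betaP η)) =
      pr ⁻¹' Up ∩ ({w : Strip | w.1 = 0 ∧ η ≤ (w.2 : ℝ)} ∪ {w : Strip | w.1 = 1 ∧ η ≤ (w.2 : ℝ)})ᶜ := by
    ext w
    constructor
    · rintro ⟨hw, hw'⟩
      refine ⟨hw, ?_⟩
      rintro (⟨h1, h2⟩ | ⟨h1, h2⟩)
      · rcases h2.lt_or_eq with h | h
        · exact hw' (Or.inl ⟨h1, h⟩)
        · have : w = z := Prod.ext (by rw [h1, hz1]) (Subtype.ext (by rw [← h, hz2]))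
          rw [this] at hw
          exact aux_X_notUp hX _ hzX hw
      · rcases h2.lt_or_eq with h | h
        · exact hw' (Or.inr ((aux_mem_shift_beta _).2 ⟨h1, h⟩))
        · have : w = shiftPt 1 z := Prod.ext (by simp [shiftPt, h1, hz1])
            (Subtype.ext (by rw [← h, ← hz2]; rfl))
          rw [this, mem_preimage, aux_pr_shift] at hw
          exact aux_X_notUp hX _ hzX hw
    · rintro ⟨hw, hw'⟩
      refine ⟨hw, ?_⟩
      rintro (⟨h1, h2⟩ | h)
      · exact hw' (Or.inl ⟨h1, h2.le⟩)
      · rw [aux_mem_shift_beta] at h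
        exact hw' (Or.inr ⟨h.1, h.2.le⟩)
  rw [e]
  refine ((aux_Up_open hX).preimage aux_pr_cont).inter (isOpen_compl_iff.2 ?_)
  have c1 : Continuous (fun w : Strip => w.1) := continuous_fst
  have c2 : Continuous (fun w : Strip => (w.2 : ℝ)) := by fun_prop
  exact ((isClosed_eq c1 continuous_const).inter (isClosed_le continuous_const c2)).union
    ((isClosed_eq c1 continuous_const).inter (isClosed_le continuous_const c2))

lemma aux_V_top (hX : IsEAC X Um Up) {η : ℝ} (hη : etaSpec (pr ⁻¹' X) η)
    (hjoin : ∀ c ∈ connectedComponentIn (pr ⁻¹' Up \ (betaP η ∪ shiftSet 1 (betaP η))) topSeg,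
      JoinedIn (pr ⁻¹' Up \ (betaP η ∪ shiftSet 1 (betaP η))) topSeg c)
    (p : Strip) (hp : p ∈ Vset (pr ⁻¹' Up) η) (hp' : (p.2 : ℝ) = 1) : p.1 ≤ 1 := by
  by_contra hlt
  push Not at hlt
  have hop : IsOpen (pr ⁻¹' Up ∩ {w : Strip | 1 < w.1}) :=
    ((aux_Up_open hX).preimage aux_pr_cont).inter (isOpen_lt continuous_const continuous_fst)
  obtain ⟨c, hc1, hc2⟩ := mem_closure_iff.1 hp.2 _ (hop.pathComponentIn p)
    (mem_pathComponentIn_self ⟨hp.1, hlt⟩)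
  have j1 : JoinedIn (pr ⁻¹' Up \ shiftSet 1 (betaP η)) topSeg c :=
    (hjoin c hc2).mono (fun w hw => ⟨hw.1, fun h => hw.2 (Or.inr h)⟩)
  have j2 : JoinedIn (pr ⁻¹' Up \ shiftSet 1 (betaP η)) p c := by
    refine JoinedIn.mono hc1 ?_
    rintro w ⟨hw1, hw2⟩
    refine ⟨hw1, fun h => ?_⟩
    rw [aux_mem_shift_beta] at h
    simp only [mem_ofPred_eq] at hw2
    linarith [h.1]
  exact aux_not_joined hX hη p hlt hp' (j1.trans j2.symm)

lemma aux_shift_cont (k : ℤ) : Continuous (shiftPt k) := by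
  unfold shiftPt; fun_prop

lemma aux_V_disj (hX : IsEAC X Um Up) {η : ℝ} (hη : etaSpec (pr ⁻¹' X) η)
    (hjoin : ∀ c ∈ connectedComponentIn (pr ⁻¹' Up \ (betaP η ∪ shiftSet 1 (betaP η))) topSeg,
      JoinedIn (pr ⁻¹' Up \ (betaP η ∪ shiftSet 1 (betaP η))) topSeg c)
    (p : Strip)
    (hp : p ∈ connectedComponentIn (pr ⁻¹' Up \ (betaP η ∪ shiftSet 1 (betaP η))) topSeg)
    (hV : shiftPt 1 p ∈ Vset (pr ⁻¹' Up) η) : False := by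
  have hinv : ∀ w, shiftPt (-1) (shiftPt 1 w) = w := by
    intro w; simp [shiftPt]
  have hinv' : ∀ w, shiftPt 1 (shiftPt (-1) w) = w := by
    intro w; simp [shiftPt]
  have hCo := (aux_S_open hX hη).connectedComponentIn (x := topSeg)
  obtain ⟨c, hc1, hc2⟩ := mem_closure_iff.1 hV.2 _ (hCo.preimage (aux_shift_cont (-1)))
    (by rw [mem_preimage, hinv]; exact hp)
  have j1 : JoinedIn (pr ⁻¹' Up \ shiftSet 1 (betaP η)) topSeg c :=
    (hjoin c hc2).mono (fun w hw => ⟨hw.1, fun h => hw.2 (Or.inr h)⟩)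
  have j2 : JoinedIn (pr ⁻¹' Up \ shiftSet 1 (betaP η)) (shiftPt 1 topSeg) c := by
    obtain ⟨δ, hδ⟩ := hjoin _ hc1
    refine ⟨(δ.map (aux_shift_cont 1)).cast rfl (hinv' c).symm, ?_⟩
    intro t
    have := hδ t
    refine ⟨?_, ?_⟩
    · change pr (shiftPt 1 (δ t)) ∈ Up
      rw [aux_pr_shift]; exact this.1
    · rintro ⟨w, hw, hw'⟩
      have hw' : shiftPt 1 w = shiftPt 1 (δ t) := hw'
      have : w = δ t := by rw [← hinv w, hw', hinv]
      exact (hδ t).2 (Or.inl (this ▸ hw))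
  refine aux_not_joined hX hη (shiftPt 1 topSeg) ?_ rfl (j1.trans j2.symm)
  simp [shiftPt, topSeg]

end HairAux

/-- Lemma `pasaporizquierda`: for every `L < 0` there is `R > 1` such that
any hair of a translate `V + k`, `k ≤ 0` (hence contained in `V⁻`), whose endpoint lies to
the right of `R` passes over `L`. -/
theorem hair_passes_left
    (X Um Up : Set Ann) (hX : IsEAC X Um Up)
    (η : ℝ) (hη : etaSpec (pr ⁻¹' X) η)
    (hbelow : ¬ BddBelow (Prod.fst '' Vset (pr ⁻¹' Up) η))
    (habove : ¬ BddAbove (Prod.fst '' Vset (pr ⁻¹' Up) η)) :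
    ∀ L : ℝ, L < 0 → ∃ R : ℝ, R > 1 ∧
      ∀ k : ℤ, k ≤ 0 → ∀ γ : unitInterval → Strip,
        IsHair (shiftSet k (Vset (pr ⁻¹' Up) η)) γ → (γ 1).1 ≥ R → L ∈ proj1 γ := by
  intro L hL
  -- a point of the open component far to the left
  obtain ⟨v, hv, hvL⟩ : ∃ v ∈ Vset (pr ⁻¹' Up) η, v.1 < L - 1 := by
    by_contra h
    push Not at h
    apply hbelow
    refine ⟨L - 1, ?_⟩
    rintro _ ⟨v, hv, rfl⟩
    exact h v hv
  obtain ⟨c, hcL, hc⟩ := mem_closure_iff.1 hv.2 {w : Strip | w.1 < L - 1}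
    (isOpen_lt continuous_fst continuous_const) hvL
  have hSo := aux_S_open hX hη
  have htop : topSeg ∈ pr ⁻¹' Up \ (betaP η ∪ shiftSet 1 (betaP η)) :=
    connectedComponentIn_nonempty_iff.1 ⟨c, hc⟩
  have hpc : IsPathConnected
      (connectedComponentIn (pr ⁻¹' Up \ (betaP η ∪ shiftSet 1 (betaP η))) topSeg) :=
    (hSo.connectedComponentIn.isConnected_iff_isPathConnected).1
      (isConnected_connectedComponentIn_iff.2 htop)
  have hjoin : ∀ c ∈ connectedComponentIn (pr ⁻¹' Up \ (betaP η ∪ shiftSet 1 (betaP η))) topSeg,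
      JoinedIn (pr ⁻¹' Up \ (betaP η ∪ shiftSet 1 (betaP η))) topSeg c := fun c hc =>
    (hpc.joinedIn _ (mem_connectedComponentIn htop) c hc).mono (connectedComponentIn_subset _ _)
  obtain ⟨α, hα⟩ := hpc.joinedIn _ (mem_connectedComponentIn htop) c hc
  have hαc : Continuous α := α.continuous
  obtain ⟨M, hM⟩ : ∃ M, ∀ s, (α s).1 ≤ M := by
    have hcp : IsCompact (range fun s => (α s).1) := isCompact_range (by fun_prop)
    obtain ⟨M, hM⟩ := hcp.bddAbove
    exact ⟨M, fun t => hM ⟨t, rfl⟩⟩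
  refine ⟨max 2 (M + 2), lt_of_lt_of_le (by norm_num) (le_max_left _ _), ?_⟩
  intro k hk γ hγ hR
  obtain ⟨hγc, -, hγ0, hγV⟩ := hγ
  have hR2 : 2 ≤ (γ 1).1 := le_trans (le_max_left _ _) hR
  have hRM : M + 2 ≤ (γ 1).1 := le_trans (le_max_right _ _) hR
  have hkR : (k : ℝ) ≤ 0 := by exact_mod_cast hk
  by_contra hLn
  have hgt : ∀ t, L < (γ t).1 := by
    intro t
    refine aux_stay_gt (fun t => (γ t).1) (by fun_prop) L ?_ 1 (by linarith) t
    intro s hs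
    exact hLn ⟨s, hs⟩
  have hγV' : ∀ t, ((γ t).1 - k, (γ t).2) ∈ Vset (pr ⁻¹' Up) η := by
    intro t
    obtain ⟨w, hw, hw'⟩ := hγV t
    have : ((γ t).1 - k, (γ t).2) = w := by
      rw [← hw']; simp [shiftPt]
    rw [this]; exact hw
  have hst : (γ 0).1 - k ≤ 1 := aux_V_top hX hη hjoin _ (hγV' 0) hγ0
  let f : unitInterval × unitInterval → ℂ := fun x =>
    (((α x.1).1 + 1 - ((γ x.2).1 - k) : ℝ) : ℂ) +
      ((((α x.1).2 : ℝ) - ((γ x.2).2 : ℝ) : ℝ) : ℂ) * Complex.I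
  have hfre : ∀ x, (f x).re = (α x.1).1 + 1 - ((γ x.2).1 - k) := by intro x; simp [f]
  have hfim : ∀ x, (f x).im = ((α x.1).2 : ℝ) - ((γ x.2).2 : ℝ) := by intro x; simp [f]
  have hf : Continuous f := by fun_prop
  have hα01 : (α 0).1 = 1 / 2 := by rw [α.source]; rfl
  have hα02 : ((α 0).2 : ℝ) = 1 := by rw [α.source]; rfl
  have hα1 : (α 1).1 < L - 1 := by rw [α.target]; exact hcL
  refine aux_crossing f hf ?_ ?_ ?_ ?_ ?_ ?_ ?_
  · intro x hx
    have e1 := hfre x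
    have e2 := hfim x
    rw [hx] at e1 e2
    simp only [Complex.zero_re, Complex.zero_im] at e1 e2
    apply aux_V_disj hX hη hjoin (α x.1) (hα x.1)
    have : shiftPt 1 (α x.1) = ((γ x.2).1 - k, (γ x.2).2) :=
      Prod.ext (by simp only [shiftPt, Int.cast_one]; linarith)
        (Subtype.ext (by simp only [shiftPt]; linarith))
    rw [this]
    exact hγV' x.2
  · rw [hfre]; simp only; linarith
  · rw [hfim]; simp only; linarith
  · intro t
    rw [hfim]; simp only
    linarith [(γ t).2.2.2]
  · intro s
    rw [hfim]; simp only
    linarith [(α s).2.2.2]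
  · intro t
    rw [hfre]; simp only
    linarith [hgt t]
  · intro s
    rw [hfre]; simp only
    linarith [hM s]
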